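/- Let K, L ≥ 2 be integers and let s = (s1,…,sK) ∈ [0,1]^K be offers with max_i si > 0. Then the symmetric responder game possesses exactly one evolutionarily stable strategy p* ∈ Δ. -/

import Mathlib

/-- `W_L(x) = (1 - (1-x)^L)/(L·x)` for `x ∈ (0,1]`, with `W_L(0) = 1`. -/
noncomputable def WL (L : ℕ) (x : ℝ) : ℝ :=
  if x = 0 then 1 else (1 - (1-x)^L) / ((L:ℝ) * x)

/-- The simplex of mixed strategies over `K` proposers. -/
def simplex (K : ℕ) : Set (Fin K → ℝ) :=
  {p | (∀ i, 0 ≤ p i) ∧ ∑ i, p i = 1}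

/-- Expected payoff of a focal responder playing `p` when each of the other
`L-1` responders plays `q`, given offers `s`. -/
noncomputable def payoff (K L : ℕ) (s p q : Fin K → ℝ) : ℝ :=
  ∑ i, s i * p i * WL L (q i)

/-- `pstar` is an evolutionarily stable strategy of the symmetric responder game. -/
def IsESS (K L : ℕ) (s pstar : Fin K → ℝ) : Prop :=
  pstar ∈ simplex K ∧ ∀ p ∈ simplex K, p ≠ pstar →
    payoff K L s p pstar < payoff K L s pstar pstar ∨
    (payoff K L s p pstar = payoff K L s pstar pstar ∧
      payoff K L s p p < payoff K L s pstar p)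

theorem WL_eq (L : ℕ) (hL : 2 ≤ L) (x : ℝ) :
    WL L x = (∑ k ∈ Finset.range L, (1-x)^k) / (L:ℝ) := by
  have hL0 : (L:ℝ) ≠ 0 := by positivity
  unfold WL
  split_ifs with h
  · subst h; simp [hL0]
  · have := geom_sum_mul (1-x) L
    rw [div_eq_div_iff (mul_ne_zero hL0 h) hL0]
    linear_combination (L:ℝ) * this

theorem WL_pos (L : ℕ) (hL : 2 ≤ L) (x : ℝ) (hx1 : x ≤ 1) : 0 < WL L x := by
  rw [WL_eq L hL]
  have hL0 : (0:ℝ) < L := by positivity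
  apply div_pos _ hL0
  apply Finset.sum_pos' (fun k _ => pow_nonneg (by linarith) k)
  exact ⟨0, Finset.mem_range.2 (by omega), by simp⟩

theorem WL_anti (L : ℕ) (hL : 2 ≤ L) (x y : ℝ) (hxy : x < y) (hy1 : y ≤ 1) :
    WL L y < WL L x := by
  rw [WL_eq L hL, WL_eq L hL]
  have hL0 : (0:ℝ) < L := by positivity
  apply div_lt_div_of_pos_right _ hL0
  apply Finset.sum_lt_sum
  · intro k _
    exact pow_le_pow_left₀ (by linarith) (by linarith) k
  · exact ⟨1, Finset.mem_range.2 (by omega), by simp; linarith⟩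

theorem WL_mul_neg (L : ℕ) (hL : 2 ≤ L) (x y : ℝ) (hx1 : x ≤ 1) (hy1 : y ≤ 1) (h : x ≠ y) :
    (x - y) * (WL L x - WL L y) < 0 := by
  rcases lt_or_gt_of_ne h with h | h
  · have := WL_anti L hL x y h hy1
    exact mul_neg_of_neg_of_pos (by linarith) (by linarith)
  · have := WL_anti L hL y x h hx1
    exact mul_neg_of_pos_of_neg (by linarith) (by linarith)

theorem WL_mul_nonpos (L : ℕ) (hL : 2 ≤ L) (x y : ℝ) (hx1 : x ≤ 1) (hy1 : y ≤ 1) :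
    (x - y) * (WL L x - WL L y) ≤ 0 := by
  by_cases h : x = y
  · simp [h]
  · exact (WL_mul_neg L hL x y hx1 hy1 h).le

theorem simplex_le_one {K : ℕ} {p : Fin K → ℝ} (hp : p ∈ simplex K) (i : Fin K) : p i ≤ 1 := by
  rw [← hp.2]
  exact Finset.single_le_sum (fun j _ => hp.1 j) (Finset.mem_univ i)

theorem payoff_diff (K L : ℕ) (s p q : Fin K → ℝ) :
    (payoff K L s p p - payoff K L s q p) - (payoff K L s p q - payoff K L s q q)
      = ∑ i, s i * ((p i - q i) * (WL L (p i) - WL L (q i))) := by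
  unfold payoff
  simp only [← Finset.sum_sub_distrib]
  exact Finset.sum_congr rfl fun i _ => by ring

noncomputable def FL (L : ℕ) (x : ℝ) : ℝ :=
  (∑ k ∈ Finset.range L, -((1-x)^(k+1) / ((k:ℝ)+1))) / (L:ℝ)

theorem FL_deriv (L : ℕ) (hL : 2 ≤ L) (x : ℝ) : HasDerivAt (FL L) (WL L x) x := by
  rw [WL_eq L hL]
  unfold FL
  apply HasDerivAt.div_const
  apply HasDerivAt.fun_sum
  intro k _
  have h1 : HasDerivAt (fun x : ℝ => 1 - x) (-1) x := by
    simpa using (hasDerivAt_id x).const_sub 1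
  have h := ((h1.pow (k+1)).div_const ((k:ℝ)+1)).neg
  have hk : (k:ℝ)+1 ≠ 0 := by positivity
  have e : -(((k+1 : ℕ):ℝ) * (1 - x) ^ (k + 1 - 1) * -1 / ((k:ℝ) + 1)) = (1-x)^k := by
    rw [Nat.add_sub_cancel]
    push_cast
    field_simp
  rw [e] at h
  exact h

theorem simplex_compact (K : ℕ) : IsCompact (simplex K) := by
  have : simplex K = stdSimplex ℝ (Fin K) := rfl
  rw [this]
  exact isCompact_stdSimplex ℝ (Fin K)

theorem simplex_convex (K : ℕ) : Convex ℝ (simplex K) := convex_stdSimplex ℝ (Fin K)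

theorem exists_nash (K L : ℕ) (hK : 2 ≤ K) (hL : 2 ≤ L) (s : Fin K → ℝ) :
    ∃ p ∈ simplex K, ∀ q ∈ simplex K, payoff K L s q p ≤ payoff K L s p p := by
  have hne : (simplex K).Nonempty :=
    ⟨Pi.single ⟨0, by omega⟩ 1, single_mem_stdSimplex ℝ _⟩
  have hd : ∀ x : Fin K → ℝ, HasFDerivAt (fun p : Fin K → ℝ => ∑ i, s i * FL L (p i))
      (∑ i, (s i * WL L (x i)) • (ContinuousLinearMap.proj i : (Fin K → ℝ) →L[ℝ] ℝ)) x := by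
    intro x
    apply HasFDerivAt.fun_sum
    intro i _
    have h2 : HasFDerivAt (fun p : Fin K → ℝ => p i)
      (ContinuousLinearMap.proj i : (Fin K → ℝ) →L[ℝ] ℝ) x :=
      (ContinuousLinearMap.proj i : (Fin K → ℝ) →L[ℝ] ℝ).hasFDerivAt
    exact HasDerivAt.comp_hasFDerivAt (h₂ := fun y => s i * FL L y) (f := fun p : Fin K → ℝ => p i) x
      ((FL_deriv L hL (x i)).const_mul (s i)) h2
  have hc : Continuous (fun p : Fin K → ℝ => ∑ i, s i * FL L (p i)) :=
    continuous_iff_continuousAt.2 fun x => (hd x).continuousAt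
  obtain ⟨p, hp, hmax⟩ := (simplex_compact K).exists_isMaxOn hne hc.continuousOn
  refine ⟨p, hp, fun q hq => ?_⟩
  have h := hmax.localize.hasFDerivWithinAt_nonpos (hd p).hasFDerivWithinAt
    (y := q - p) (sub_mem_posTangentConeAt_of_segment_subset ((simplex_convex K).segment_subset hp hq))
  have e : payoff K L s q p - payoff K L s p p =
      (∑ i, (s i * WL L (p i)) • (ContinuousLinearMap.proj i : (Fin K → ℝ) →L[ℝ] ℝ)) (q - p) := by
    unfold payoff
    rw [← Finset.sum_sub_distrib]
    simp only [ContinuousLinearMap.sum_apply, ContinuousLinearMap.smul_apply,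
      ContinuousLinearMap.proj_apply, Pi.sub_apply, smul_eq_mul]
    exact Finset.sum_congr rfl fun i _ => by ring
  linarith

theorem nash_zero (K L : ℕ) (hL : 2 ≤ L) (s : Fin K → ℝ) (j : Fin K) (hj : 0 < s j)
    (p : Fin K → ℝ) (hp : p ∈ simplex K)
    (hn : ∀ q ∈ simplex K, payoff K L s q p ≤ payoff K L s p p) (i : Fin K) (hi : s i = 0) :
    p i = 0 := by
  by_contra h0
  have hpi : 0 < p i := lt_of_le_of_ne (hp.1 i) (Ne.symm h0)
  let q : Fin K → ℝ := fun k => p k + p i * (Pi.single (M := fun _ => ℝ) j (1:ℝ) k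
    - Pi.single (M := fun _ => ℝ) i (1:ℝ) k)
  have hq : q ∈ simplex K := by
    constructor
    · intro k
      have h1 := hp.1 k
      by_cases hk : k = i
      · subst hk
        have : (0:ℝ) ≤ Pi.single (M := fun _ => ℝ) j (1:ℝ) k := by
          rw [Pi.single_apply]; split_ifs <;> norm_num
        simp only [q, Pi.single_eq_same]
        nlinarith
      · have : (0:ℝ) ≤ Pi.single (M := fun _ => ℝ) j (1:ℝ) k := by
          rw [Pi.single_apply]; split_ifs <;> norm_num
        simp only [q, Pi.single_eq_of_ne hk]
        nlinarith
    · simp only [q, Finset.sum_add_distrib, ← Finset.mul_sum, Finset.sum_sub_distrib, hp.2]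
      simp
  have e : payoff K L s q p - payoff K L s p p
      = p i * (s j * WL L (p j)) - p i * (s i * WL L (p i)) := by
    unfold payoff
    rw [← Finset.sum_sub_distrib]
    have : ∀ k, s k * q k * WL L (p k) - s k * p k * WL L (p k)
        = Pi.single (M := fun _ => ℝ) j (1:ℝ) k * (p i * (s k * WL L (p k)))
          - Pi.single (M := fun _ => ℝ) i (1:ℝ) k * (p i * (s k * WL L (p k))) := by
      intro k; simp only [q]; ring
    simp [this, Finset.sum_sub_distrib, Pi.single_apply]
  have h2 := hn q hq
  have h3 := mul_pos hpi (mul_pos hj (WL_pos L hL (p j) (simplex_le_one hp j)))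
  rw [hi] at e
  linarith

theorem stmt12 (K L : ℕ) (hK : 2 ≤ K) (hL : 2 ≤ L)
    (s : Fin K → ℝ) (hs : ∀ i, s i ∈ Set.Icc (0:ℝ) 1) (hpos : ∃ i, 0 < s i) :
    ∃! pstar : Fin K → ℝ, IsESS K L s pstar := by
  obtain ⟨j, hj⟩ := hpos
  obtain ⟨p, hp, hn⟩ := exists_nash K L hK hL s
  have hterm : ∀ a ∈ simplex K, ∀ b ∈ simplex K, ∀ i,
      s i * ((a i - b i) * (WL L (a i) - WL L (b i))) ≤ 0 := fun a ha b hb i =>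
    mul_nonpos_of_nonneg_of_nonpos (hs i).1
      (WL_mul_nonpos L hL _ _ (simplex_le_one ha i) (simplex_le_one hb i))
  refine ⟨p, ⟨hp, fun q hq hne => ?_⟩, fun q hq => ?_⟩
  · rcases (hn q hq).lt_or_eq with h | h
    · exact Or.inl h
    · refine Or.inr ⟨h, ?_⟩
      have hlt : ∑ i, s i * ((q i - p i) * (WL L (q i) - WL L (p i))) < 0 := by
        by_contra hge
        have h0 : ∑ i, s i * ((q i - p i) * (WL L (q i) - WL L (p i))) = 0 :=
          le_antisymm (Finset.sum_nonpos fun i _ => hterm q hq p hp i) (not_lt.1 hge)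
        rw [Finset.sum_eq_zero_iff_of_nonpos fun i _ => hterm q hq p hp i] at h0
        have hle : ∀ i, p i ≤ q i := by
          intro i
          by_cases hi : s i = 0
          · rw [nash_zero K L hL s j hj p hp hn i hi]
            exact hq.1 i
          · by_contra hc
            have h1 := WL_mul_neg L hL (q i) (p i) (simplex_le_one hq i) (simplex_le_one hp i)
              (fun h => hc h.ge)
            rcases mul_eq_zero.1 (h0 i (Finset.mem_univ i)) with h2 | h2
            · exact hi h2
            · exact h1.ne h2
        have hall := (Finset.sum_eq_sum_iff_of_le (fun i _ => hle i)).1 (hp.2.trans hq.2.symm)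
        exact hne (funext fun i => (hall i (Finset.mem_univ i)).symm)
      have := payoff_diff K L s q p
      linarith
  · by_contra hne
    have h1 := hq.2 p hp (Ne.symm hne)
    have h2 := hn q hq.1
    have h3 := payoff_diff K L s q p
    have h4 := Finset.sum_nonpos fun i (_ : i ∈ Finset.univ) => hterm q hq.1 p hp i
    rcases h1 with h1 | ⟨h1, h5⟩
    · linarith
    · linarith
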